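/- There is a unique k-algebra automorphism ν : B → B with ν(x) = −q⁻¹x and ν(y) = −qy, and it satisfies ν(bw) = bw for every b ∈ B; in particular ν(w) = w. -/

import Mathlib

noncomputable section
open FreeAlgebra Matrix

/-- The defining relations of `B = k⟨x,y⟩/(x², y², xyx, yxy)`. -/
inductive BRel (k : Type*) [Field k] : FreeAlgebra k (Fin 2) → FreeAlgebra k (Fin 2) → Prop
  | xx : BRel k (ι k 0 * ι k 0) 0
  | yy : BRel k (ι k 1 * ι k 1) 0
  | xyx : BRel k (ι k 0 * ι k 1 * ι k 0) 0
  | yxy : BRel k (ι k 1 * ι k 0 * ι k 1) 0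

/-- The algebra `B = k⟨x,y⟩/(x², y², xyx, yxy)`. -/
abbrev B (k : Type*) [Field k] := RingQuot (BRel k)

/-- The image of the generator `x` in `B`. -/
def Bx (k : Type*) [Field k] : B k := RingQuot.mkAlgHom k (BRel k) (ι k 0)

/-- The image of the generator `y` in `B`. -/
def By (k : Type*) [Field k] : B k := RingQuot.mkAlgHom k (BRel k) (ι k 1)

/-- The element `w = xy - q·yx` of `B`. -/
def wB (k : Type*) [Field k] (q : k) : B k := Bx k * By k - q • (By k * Bx k)

/-- `neg_smul` for the negation on `B` coming from `RingQuot`. -/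
theorem B.neg_smul {k : Type*} [Field k] (a : k) (b : B k) : (-a) • b = -(a • b) :=
  _root_.neg_smul a b

theorem Bx_mul_Bx (k : Type*) [Field k] : Bx k * Bx k = 0 := by
  simpa [Bx] using RingQuot.mkAlgHom_rel k (BRel.xx (k := k))

theorem By_mul_By (k : Type*) [Field k] : By k * By k = 0 := by
  simpa [By] using RingQuot.mkAlgHom_rel k (BRel.yy (k := k))

theorem Bx_mul_By_mul_Bx (k : Type*) [Field k] : Bx k * By k * Bx k = 0 := by
  simpa [Bx, By] using RingQuot.mkAlgHom_rel k (BRel.xyx (k := k))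

theorem By_mul_Bx_mul_By (k : Type*) [Field k] : By k * Bx k * By k = 0 := by
  simpa [Bx, By] using RingQuot.mkAlgHom_rel k (BRel.yxy (k := k))

/-- Algebra homomorphisms out of `B` agree once they agree on the two generators. -/
theorem B.algHom_ext {k A : Type*} [Field k] [Semiring A] [Algebra k A] {f g : B k →ₐ[k] A}
    (hx : f (Bx k) = g (Bx k)) (hy : f (By k) = g (By k)) : f = g := by
  apply RingQuot.ringQuot_ext'
  apply FreeAlgebra.hom_ext
  funext i
  fin_cases i
  · exact hx
  · exact hy

/-- The endomorphism of `B` that rescales the generators by `a` and `c`. -/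
def B.scale (k : Type*) [Field k] (a c : k) : B k →ₐ[k] B k :=
  RingQuot.liftAlgHom k ⟨FreeAlgebra.lift k ![a • Bx k, c • By k], by
    rintro _ _ (_ | _ | _ | _) <;>
      simp [Bx_mul_Bx, By_mul_By, Bx_mul_By_mul_Bx, By_mul_Bx_mul_By]⟩

theorem B.scale_Bx (k : Type*) [Field k] (a c : k) : B.scale k a c (Bx k) = a • Bx k := by
  simp [B.scale, Bx]

theorem B.scale_By (k : Type*) [Field k] (a c : k) : B.scale k a c (By k) = c • By k := by
  simp [B.scale, By]

theorem B.scale_comp_scale (k : Type*) [Field k] {a c a' c' : k} (ha : a * a' = 1)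
    (hc : c * c' = 1) : (B.scale k a c).comp (B.scale k a' c') = AlgHom.id k (B k) := by
  apply B.algHom_ext
  · simp [B.scale_Bx, smul_smul, mul_comm a', ha]
  · simp [B.scale_By, smul_smul, mul_comm c', hc]

/-- The automorphism of `B` that rescales the generators by invertible scalars. -/
def B.scaleEquiv (k : Type*) [Field k] (a c : k) (ha : a ≠ 0) (hc : c ≠ 0) : B k ≃ₐ[k] B k :=
  AlgEquiv.ofAlgHom (B.scale k a c) (B.scale k a⁻¹ c⁻¹)
    (B.scale_comp_scale k (mul_inv_cancel₀ ha) (mul_inv_cancel₀ hc))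
    (B.scale_comp_scale k (inv_mul_cancel₀ ha) (inv_mul_cancel₀ hc))

theorem Bx_mul_wB (k : Type*) [Field k] (q : k) : Bx k * wB k q = 0 := by
  simp [wB, mul_sub, ← mul_assoc, Bx_mul_Bx, Bx_mul_By_mul_Bx]

theorem By_mul_wB (k : Type*) [Field k] (q : k) : By k * wB k q = 0 := by
  simp [wB, mul_sub, ← mul_assoc, By_mul_By, By_mul_Bx_mul_By]

/-- The left ideal generated by `w` is spanned by `w`. -/
theorem exists_mul_wB_eq_smul (k : Type*) [Field k] (q : k) (b : B k) :
    ∃ c : k, b * wB k q = c • wB k q := by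
  obtain ⟨b, rfl⟩ := RingQuot.mkAlgHom_surjective k (BRel k) b
  induction b using FreeAlgebra.induction with
  | grade0 r => exact ⟨r, by rw [AlgHom.commutes, Algebra.smul_def]⟩
  | grade1 i =>
    refine ⟨0, ?_⟩
    rw [zero_smul]
    fin_cases i
    · exact Bx_mul_wB k q
    · exact By_mul_wB k q
  | mul a b ha hb =>
    obtain ⟨c, hc⟩ := ha
    obtain ⟨d, hd⟩ := hb
    exact ⟨d * c, by rw [map_mul, mul_assoc, hd, mul_smul_comm, hc, smul_smul]⟩
  | add a b ha hb =>
    obtain ⟨c, hc⟩ := ha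
    obtain ⟨d, hd⟩ := hb
    exact ⟨c + d, by rw [map_add, add_mul, hc, hd, add_smul]⟩

theorem stmt1 (k : Type*) [Field k] (q : k) (hq : q ≠ 0) :
    (∃! ν : B k ≃ₐ[k] B k,
        ν (Bx k) = -(q⁻¹ • Bx k) ∧ ν (By k) = -(q • By k)) ∧
    (∀ ν : B k ≃ₐ[k] B k,
        ν (Bx k) = -(q⁻¹ • Bx k) → ν (By k) = -(q • By k) →
        (∀ b : B k, ν (b * wB k q) = b * wB k q) ∧ ν (wB k q) = wB k q) := by
  refine ⟨⟨B.scaleEquiv k (-q⁻¹) (-q) (neg_ne_zero.2 (inv_ne_zero hq)) (neg_ne_zero.2 hq),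
    ⟨?_, ?_⟩, ?_⟩, ?_⟩
  · exact (B.scale_Bx k _ _).trans (B.neg_smul _ _)
  · exact (B.scale_By k _ _).trans (B.neg_smul _ _)
  · rintro ν ⟨hx, hy⟩
    refine AlgEquiv.coe_toAlgHom_injective (B.algHom_ext ?_ ?_)
    · exact hx.trans ((B.scale_Bx k _ _).trans (B.neg_smul _ _)).symm
    · exact hy.trans ((B.scale_By k _ _).trans (B.neg_smul _ _)).symm
  · intro ν hx hy
    have hw : ν (wB k q) = wB k q := by
      rw [← B.neg_smul] at hx hy
      simp [wB, hx, hy, smul_smul, hq]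
    refine ⟨fun b => ?_, hw⟩
    obtain ⟨c, hc⟩ := exists_mul_wB_eq_smul k q b
    rw [hc, map_smul, hw]
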